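/- Let K = u/v be shift-reduced with K ≠ 1. Then the F-linear map φ_K : F[y] → F[y], p ↦ u·σ(p) − v·p, is injective. -/

import Mathlib

open Polynomial

noncomputable def pshift (F : Type*) [Field F] (i : ℤ) :
    Polynomial F →ₐ[F] Polynomial F :=
  aeval (X + C (i : F))

noncomputable def rshift (F : Type*) [Field F] (i : ℤ) : RatFunc F → RatFunc F :=
  fun f => RatFunc.mk (pshift F i f.num) (pshift F i f.denom)

def shiftFree {F : Type*} [Field F] (p : Polynomial F) : Prop :=
  p ≠ 0 ∧ ∀ i : ℤ, i ≠ 0 → IsCoprime p (pshift F i p)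

def shiftReducedPair {F : Type*} [Field F] (u v : Polynomial F) : Prop :=
  u ≠ 0 ∧ v ≠ 0 ∧ IsCoprime u v ∧ ∀ i : ℤ, IsCoprime u (pshift F i v)

def stronglyPrime {F : Type*} [Field F] (p u v : Polynomial F) : Prop :=
  p ≠ 0 ∧ ∀ i : ℕ, IsCoprime p (pshift F (-(i : ℤ)) u) ∧ IsCoprime p (pshift F (i : ℤ) v)

noncomputable def phiK {F : Type*} [Field F] (u v : Polynomial F) :
    Polynomial F → Polynomial F :=
  fun p => u * pshift F 1 p - v * p

noncomputable def WK (F : Type*) [Field F] (u v : Polynomial F) :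
    Submodule F (Polynomial F) :=
  Submodule.span F {q : Polynomial F | ∃ ℓ : ℕ, q = X ^ ℓ ∧
    ∀ w : Polynomial F, w ∈ Set.range (phiK u v) → w ≠ 0 → ℓ ≠ w.natDegree}

def VK {F : Type*} [Field F] (K : RatFunc F) : Set (RatFunc F) :=
  {g | ∃ r : RatFunc F, g = K * rshift F 1 r - r}

def residualForm {F : Type*} [Field F] (u v : Polynomial F) (r : RatFunc F) : Prop :=
  ∃ a b q : Polynomial F, a.degree < b.degree ∧ shiftFree b ∧ stronglyPrime b u v ∧
    q ∈ WK F u v ∧ r = RatFunc.mk a b + RatFunc.mk q v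

section Shift

variable {F : Type*} [Field F]

theorem pshift_eq_comp (i : ℤ) (p : F[X]) : pshift F i p = p.comp (X + C (i : F)) := rfl

theorem pshift_pshift (i j : ℤ) (p : F[X]) :
    pshift F i (pshift F j p) = pshift F (i + j) p := by
  simp only [pshift_eq_comp, comp_assoc]
  congr 1
  simp [add_assoc]

theorem pshift_zero (p : F[X]) : pshift F 0 p = p := by
  simp [pshift_eq_comp]

theorem natDegree_pshift (i : ℤ) (p : F[X]) : (pshift F i p).natDegree = p.natDegree := by
  rw [pshift_eq_comp, natDegree_comp, natDegree_X_add_C, mul_one]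

theorem leadingCoeff_pshift (i : ℤ) (p : F[X]) :
    (pshift F i p).leadingCoeff = p.leadingCoeff := by
  rw [pshift_eq_comp, leadingCoeff_comp (by rw [natDegree_X_add_C]; exact one_ne_zero),
    leadingCoeff_X_add_C, one_pow, mul_one]

theorem pshift_ne_zero (i : ℤ) {p : F[X]} (hp : p ≠ 0) : pshift F i p ≠ 0 := by
  rwa [← leadingCoeff_ne_zero, leadingCoeff_pshift, leadingCoeff_ne_zero]

theorem shiftReducedPair.isCoprime_pshift {u v : F[X]} (h : shiftReducedPair u v) (i j : ℤ) :
    IsCoprime (pshift F i u) (pshift F j v) := by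
  have := (h.2.2.2 (j - i)).map (pshift F i).toRingHom
  simpa [pshift_pshift] using this

theorem prod_pshift_mul_pshift {u v p : F[X]} (h : u * pshift F 1 p = v * p) (n : ℕ) :
    (∏ i ∈ Finset.range n, pshift F i u) * pshift F n p =
      (∏ i ∈ Finset.range n, pshift F i v) * p := by
  induction n with
  | zero => simp [pshift_zero]
  | succ n ih =>
    have hn := congrArg (pshift F n) h
    simp only [map_mul, pshift_pshift] at hn
    rw [Finset.prod_range_succ, Finset.prod_range_succ, mul_assoc, Nat.cast_succ, hn,
      mul_left_comm, ih]
    ring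

theorem shiftReducedPair.natDegree_eq_zero {u v p : F[X]} (hsr : shiftReducedPair u v)
    (hp : p ≠ 0) (h : u * pshift F 1 p = v * p) : u.natDegree = 0 := by
  by_contra hu
  let n := p.natDegree + 1
  have hdvd : ∏ i ∈ Finset.range n, pshift F i u ∣ p := by
    refine IsCoprime.dvd_of_dvd_mul_left ?_ ⟨_, (prod_pshift_mul_pshift h n).symm⟩
    exact IsCoprime.prod_left fun i _ => IsCoprime.prod_right fun j _ =>
      hsr.isCoprime_pshift i j
  have hle := natDegree_le_of_dvd hdvd hp
  rw [natDegree_prod _ _ fun (i : ℕ) _ => pshift_ne_zero (i : ℤ) hsr.1] at hle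
  simp only [natDegree_pshift, Finset.sum_const, Finset.card_range, smul_eq_mul] at hle
  have := Nat.le_mul_of_pos_right n (Nat.pos_of_ne_zero hu)
  lia

theorem shiftReducedPair.eq_of_mul_pshift_eq {u v p : F[X]} (hsr : shiftReducedPair u v)
    (hp : p ≠ 0) (h : u * pshift F 1 p = v * p) : u = v := by
  have hu := hsr.natDegree_eq_zero hp h
  have hdeg := congrArg natDegree h
  rw [natDegree_mul hsr.1 (pshift_ne_zero 1 hp), natDegree_mul hsr.2.1 hp,
    natDegree_pshift] at hdeg
  have hv : v.natDegree = 0 := by lia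
  have hlc := congrArg leadingCoeff h
  rw [leadingCoeff_mul, leadingCoeff_mul, leadingCoeff_pshift] at hlc
  have huv := mul_right_cancel₀ (leadingCoeff_ne_zero.mpr hp) hlc
  rw [leadingCoeff, leadingCoeff, hu, hv] at huv
  rw [eq_C_of_natDegree_eq_zero hu, eq_C_of_natDegree_eq_zero hv, huv]

end Shift

/-- The map φ_K : p ↦ u·σ(p) − v·p is injective. -/
theorem stmt3 {F : Type*} [Field F] [CharZero F] (u v : Polynomial F)
    (hsr : shiftReducedPair u v) (hK1 : RatFunc.mk u v ≠ 1) :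
    Function.Injective (phiK u v) := by
  intro p q hpq
  by_contra hne
  have h : u * pshift F 1 (p - q) = v * (p - q) := by
    simp only [phiK] at hpq
    rw [map_sub]
    linear_combination hpq
  have huv := hsr.eq_of_mul_pshift_eq (sub_ne_zero.mpr hne) h
  refine hK1 ?_
  rw [huv, RatFunc.mk_eq_div, div_self (RatFunc.algebraMap_ne_zero hsr.2.1)]
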